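/- Let n and m be positive integers with m ∣ n, m ≥ 2, n even, and 2m ∤ n (equivalently n/m odd). Let G be the subgroup of the permutation group of ZMod n generated by the translation t : x ↦ x + (n/m) (where n/m is cast into ZMod n) and the negation ν : x ↦ −x. Then the number of orbits of the action of G on ZMod n equals (n + m)/(2m). -/

import Mathlib

open MulAction in
/-- The orbits on `ZMod n` of the group generated by `x ↦ x + d` and `x ↦ -x` are the fibres of
reduction modulo `d` up to sign. -/
theorem ZMod.orbitRel_closure_addRight_neg_iff {n d : ℕ} (hd : d ∣ n) (x y : ZMod n) :
    orbitRel (Subgroup.closure {Equiv.addRight (d : ZMod n), Equiv.neg (ZMod n)} :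
        Subgroup (Equiv.Perm (ZMod n))) (ZMod n) x y ↔
      ZMod.castHom hd (ZMod d) x = ZMod.castHom hd (ZMod d) y ∨
        ZMod.castHom hd (ZMod d) x = -ZMod.castHom hd (ZMod d) y := by
  set H : Subgroup (Equiv.Perm (ZMod n)) :=
    Subgroup.closure {Equiv.addRight (d : ZMod n), Equiv.neg (ZMod n)} with hH
  set φ := ZMod.castHom hd (ZMod d)
  have ht : Equiv.addRight (d : ZMod n) ∈ H := Subgroup.subset_closure (by simp)
  have hν : Equiv.neg (ZMod n) ∈ H := Subgroup.subset_closure (by simp)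
  rw [orbitRel_apply]
  constructor
  · rintro ⟨⟨g, hg⟩, rfl⟩
    change φ (g y) = φ y ∨ φ (g y) = -φ y
    induction hg using Subgroup.closure_induction generalizing y with
    | mem g hg =>
      rcases hg with rfl | rfl
      · left; simp
      · right; simp
    | one => simp
    | mul g h _ _ ihg ihh =>
      rw [Equiv.Perm.mul_apply]
      rcases ihg (h y) with h₁ | h₁ <;> rcases ihh y with h₂ | h₂ <;> simp [h₁, h₂]
    | inv g _ ih =>
      rcases ih (g⁻¹ y) with h₁ | h₁ <;> rw [show g (g⁻¹ y) = y from g.apply_symm_apply y] at h₁ <;> simp [h₁]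
  · have translate (x y : ZMod n) (h : φ x = φ y) : x ∈ orbit H y := by
      obtain ⟨a, rfl⟩ := ZMod.intCast_surjective x
      obtain ⟨b, rfl⟩ := ZMod.intCast_surjective y
      rw [map_intCast, map_intCast, eq_comm, ZMod.intCast_eq_intCast_iff_dvd_sub] at h
      obtain ⟨k, hk⟩ := h
      refine ⟨⟨Equiv.addRight (d : ZMod n) ^ k, H.zpow_mem ht k⟩, ?_⟩
      change (Equiv.addRight (d : ZMod n) ^ k) (b : ZMod n) = a
      rw [Equiv.zsmul_addRight, Equiv.coe_addRight, eq_add_of_sub_eq hk]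
      push_cast
      simp
      ring
    rintro (h | h)
    · exact translate x y h
    · rw [← map_neg] at h
      rw [← orbit_eq_iff.2 (⟨⟨_, hν⟩, rfl⟩ : -y ∈ orbit H y)]
      exact translate x (-y) h

/-- For `d ∣ n` with `d` positive, the group generated by `x ↦ x + d` and `x ↦ -x` has
`d / 2 + 1` orbits on `ZMod n`. -/
theorem ZMod.card_orbits_closure_addRight_neg {n d : ℕ} [NeZero d] (hd : d ∣ n) :
    Nat.card (MulAction.orbitRel.Quotient
      (Subgroup.closure {Equiv.addRight (d : ZMod n), Equiv.neg (ZMod n)} :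
        Subgroup (Equiv.Perm (ZMod n))) (ZMod n)) = d / 2 + 1 := by
  let f (x : ZMod n) : Fin (d / 2 + 1) :=
    ⟨(ZMod.castHom hd (ZMod d) x).valMinAbs.natAbs,
      Nat.lt_succ_of_le (ZMod.natAbs_valMinAbs_le _)⟩
  have hf (x y : ZMod n) : f x = f y ↔ MulAction.orbitRel (Subgroup.closure
      {Equiv.addRight (d : ZMod n), Equiv.neg (ZMod n)} :
        Subgroup (Equiv.Perm (ZMod n))) (ZMod n) x y := by
    rw [ZMod.orbitRel_closure_addRight_neg_iff hd, Fin.mk.injEq,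
      ZMod.natAbs_valMinAbs_eq_natAbs_valMinAbs]
  rw [← Nat.card_fin (d / 2 + 1)]
  refine Nat.card_eq_of_bijective (Quotient.lift f fun x y h => (hf x y).2 h) ⟨?_, ?_⟩
  · rintro ⟨x⟩ ⟨y⟩ h
    exact Quotient.sound ((hf x y).1 h)
  · intro i
    refine ⟨Quotient.mk _ ((i : ℕ) : ZMod n), Fin.ext ?_⟩
    change (ZMod.castHom hd (ZMod d) ((i : ℕ) : ZMod n)).valMinAbs.natAbs = i
    rw [map_natCast, ZMod.valMinAbs_natCast_of_le_half (Nat.le_of_lt_succ i.2), Int.natAbs_natCast]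


/-- For `m ∣ n`, `m ≥ 2`, `n` even, `2m ∤ n`, the subgroup of `Perm (ZMod n)` generated
by `x ↦ x + n/m` and `x ↦ -x` has `(n + m)/(2m)` orbits on `ZMod n`. -/
theorem card_orbits_dihedral_n_even_not_two_m_dvd (n m : ℕ) (hn : 0 < n) (hm : 2 ≤ m)
    (hdvd : m ∣ n) (heven : Even n) (hndvd : ¬ (2 * m ∣ n)) :
    Nat.card (MulAction.orbitRel.Quotient
      (Subgroup.closure
        {Equiv.addRight ((n / m : ℕ) : ZMod n), Equiv.neg (ZMod n)} :
        Subgroup (Equiv.Perm (ZMod n)))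
      (ZMod n)) = (n + m) / (2 * m) := by
  obtain ⟨d, rfl⟩ := hdvd
  have hm0 : 0 < m := by omega
  have hd0 : 0 < d := Nat.pos_of_mul_pos_left hn
  have hodd : Odd d := by
    rw [← Nat.not_even_iff_odd, even_iff_two_dvd]
    intro h
    exact hndvd (mul_comm 2 m ▸ Nat.mul_dvd_mul_left m h)
  have : NeZero d := ⟨hd0.ne'⟩
  rw [Nat.mul_div_cancel_left d hm0, ZMod.card_orbits_closure_addRight_neg (dvd_mul_left d m),
    show m * d + m = m * (d + 1) by ring, mul_comm 2 m, Nat.mul_div_mul_left _ _ hm0]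
  obtain ⟨k, rfl⟩ := hodd
  omega
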